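/- Let S be a simple projective A-module and let P_1 and P_0 be finite-dimensional projective A-modules. Suppose there exists a homomorphism f : P_1 → P_0 with rank(f) = r(P_1,P_0) and Hom_A(S, Coker(f)) ≠ 0. Then r(P_1 ⊕ S, P_0) = r(P_1, P_0) + dim_K(S). -/

import Mathlib

/-- The rank of an `A`-linear map between modules over a `K`-algebra `A`:
the `K`-dimension of its image. -/
noncomputable def rk (K : Type*) [Field K] {A : Type*} [Ring A] [Algebra K A]
    {M N : Type*} [AddCommGroup M] [Module A M]
    [AddCommGroup N] [Module A N] [Module K N] [IsScalarTower K A N]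
    (f : M →ₗ[A] N) : ℕ :=
  Module.finrank K ((LinearMap.range f).restrictScalars K)

/-- `rmax K A M N` is `r(M,N)`, the maximal rank of an `A`-linear map `M → N`. -/
noncomputable def rmax (K : Type*) [Field K] (A : Type*) [Ring A] [Algebra K A]
    (M N : Type*) [AddCommGroup M] [Module A M]
    [AddCommGroup N] [Module A N] [Module K N] [IsScalarTower K A N] : ℕ :=
  sSup {n : ℕ | ∃ f : M →ₗ[A] N, rk K f = n}

section Rank

variable {K A : Type*} [Field K] [Ring A] [Algebra K A]
  {M N L : Type*} [AddCommGroup M] [Module A M]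
  [AddCommGroup N] [Module A N] [Module K N] [IsScalarTower K A N]
  [AddCommGroup L] [Module A L]

theorem rk_le_finrank_codomain [FiniteDimensional K N] (f : M →ₗ[A] N) :
    rk K f ≤ Module.finrank K N :=
  Submodule.finrank_le _

theorem rk_le_finrank_domain [Module K L] [IsScalarTower K A L]
    [FiniteDimensional K L] (f : L →ₗ[A] N) :
    rk K f ≤ Module.finrank K L :=
  (f.restrictScalars K).finrank_range_le

theorem rk_eq_finrank_of_injective [Module K L] [IsScalarTower K A L]
    {f : L →ₗ[A] N} (hf : Function.Injective f) :
    rk K f = Module.finrank K L :=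
  LinearMap.finrank_range_of_inj (f := f.restrictScalars K) hf

theorem bddAbove_rk [FiniteDimensional K N] : BddAbove {n : ℕ | ∃ f : M →ₗ[A] N, rk K f = n} :=
  ⟨Module.finrank K N, by rintro _ ⟨f, rfl⟩; exact rk_le_finrank_codomain f⟩

theorem rk_le_rmax [FiniteDimensional K N] (f : M →ₗ[A] N) : rk K f ≤ rmax K A M N :=
  le_csSup bddAbove_rk ⟨f, rfl⟩

theorem rmax_le {n : ℕ} (h : ∀ f : M →ₗ[A] N, rk K f ≤ n) : rmax K A M N ≤ n :=
  csSup_le ⟨_, 0, rfl⟩ (by rintro _ ⟨f, rfl⟩; exact h f)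

theorem rk_coprod_add_finrank_inf [FiniteDimensional K N]
    (f : M →ₗ[A] N) (g : L →ₗ[A] N) :
    rk K (f.coprod g) +
      Module.finrank K ((LinearMap.range f ⊓ LinearMap.range g).restrictScalars K) =
    rk K f + rk K g := by
  have h := Submodule.finrank_sup_add_finrank_inf_eq
    ((LinearMap.range f).restrictScalars K) ((LinearMap.range g).restrictScalars K)
  rwa [← Submodule.restrictScalars_sup, ← Submodule.restrictScalars_inf,
    ← LinearMap.range_coprod] at h

theorem rmax_prod_le [Module K L] [IsScalarTower K A L]
    [FiniteDimensional K N] [FiniteDimensional K L] :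
    rmax K A (M × L) N ≤ rmax K A M N + Module.finrank K L := by
  refine rmax_le fun g => ?_
  have h := rk_coprod_add_finrank_inf (K := K)
    (g ∘ₗ LinearMap.inl A M L) (g ∘ₗ LinearMap.inr A M L)
  rw [LinearMap.coprod_comp_inl_inr] at h
  have h₁ := rk_le_rmax (K := K) (g ∘ₗ LinearMap.inl A M L)
  have h₂ := rk_le_finrank_domain (K := K) (g ∘ₗ LinearMap.inr A M L)
  omega

theorem rk_coprod_of_mkQ_comp_injective [Module K L] [IsScalarTower K A L]
    [FiniteDimensional K N]
    {f : M →ₗ[A] N} {g : L →ₗ[A] N}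
    (h : Function.Injective ((LinearMap.range f).mkQ ∘ₗ g)) :
    rk K (f.coprod g) = rk K f + Module.finrank K L := by
  have hinf : LinearMap.range f ⊓ LinearMap.range g = ⊥ := by
    rw [eq_bot_iff]
    rintro _ ⟨hx, s, rfl⟩
    have hs : s = 0 := h (by simpa using hx)
    simp [hs]
  have hg : Function.Injective g := Function.Injective.of_comp (f := (LinearMap.range f).mkQ) h
  have key := rk_coprod_add_finrank_inf (K := K) f g
  rw [hinf, Submodule.restrictScalars_bot, finrank_bot, add_zero] at key
  rw [key, rk_eq_finrank_of_injective hg]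

end Rank

theorem stmt4 {K A : Type*} [Field K] [IsAlgClosed K] [Ring A] [Algebra K A]
    [FiniteDimensional K A]
    {S : Type*} [AddCommGroup S] [Module A S] [Module K S] [IsScalarTower K A S]
    [FiniteDimensional K S]
    (hSsimple : IsSimpleModule A S) (hSproj : Module.Projective A S)
    {P₁ P₀ : Type*}
    [AddCommGroup P₁] [Module A P₁] [Module K P₁] [IsScalarTower K A P₁] [FiniteDimensional K P₁]
    [AddCommGroup P₀] [Module A P₀] [Module K P₀] [IsScalarTower K A P₀] [FiniteDimensional K P₀]
    (hP₁proj : Module.Projective A P₁) (hP₀proj : Module.Projective A P₀)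
    (hex : ∃ f : P₁ →ₗ[A] P₀, rk K f = rmax K A P₁ P₀ ∧
      ∃ φ : S →ₗ[A] (P₀ ⧸ LinearMap.range f), φ ≠ 0) :
    rmax K A (P₁ × S) P₀ = rmax K A P₁ P₀ + Module.finrank K S := by
  obtain ⟨f, hf, φ, hφ⟩ := hex
  refine le_antisymm rmax_prod_le ?_
  obtain ⟨ψ, hψ⟩ := Module.projective_lifting_property (LinearMap.range f).mkQ φ
    (Submodule.mkQ_surjective _)
  have hinj : Function.Injective ((LinearMap.range f).mkQ ∘ₗ ψ) :=
    hψ ▸ LinearMap.injective_of_ne_zero hφ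
  rw [← hf, ← rk_coprod_of_mkQ_comp_injective hinj]
  exact rk_le_rmax _
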